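/- arXiv:2008.03463 — 3 statements merged into one kernel-verified Lean document; each statement's English description precedes it below -/
import Mathlib

section
/- Let Σ_A be the renewal shift, φ : Σ_A → ℝ a weakly Hölder continuous potential, and β > 0 with P_G(βφ) < ∞. Let ν be a nonzero σ-finite Borel measure on Σ_A, finite on every cylinder, with L*_{βφ} ν = e^{P_G(βφ)} ν. For 1 ≤ j ≤ n, let γ_j^n denote the periodic point of Σ_A with period word (j, j−1, …, 1, n, n−1, …, j+1). If limsup_{n→∞} (1/n) Σ_{j=2}^n φ(γ_j^n) > P_G(βφ)/β, then ν(Σ_A) = ∞. -/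
open MeasureTheory Filter Topology ENNReal

namespace CMS

/-- A sequence is admissible for the transition matrix `A`. -/
def IsAdm (A : ℕ → ℕ → Bool) (u : ℕ → ℕ) : Prop := ∀ i, A (u i) (u (i + 1)) = true

/-- The one-sided countable topological Markov shift. -/
abbrev Space (A : ℕ → ℕ → Bool) := {u : ℕ → ℕ // IsAdm A u}

/-- The transition matrix has no row and no column identically zero. -/
def NoDegenerate (A : ℕ → ℕ → Bool) : Prop :=
  (∀ i, ∃ j, A i j = true) ∧ (∀ j, ∃ i, A i j = true)

/-- The shift map. -/
def shift {A : ℕ → ℕ → Bool} (x : Space A) : Space A :=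
  ⟨fun i => x.1 (i + 1), fun i => x.2 (i + 1)⟩

/-- Birkhoff (ergodic) sum `φ_n`. -/
noncomputable def birkhoff {A : ℕ → ℕ → Bool} (φ : Space A → ℝ) (n : ℕ) (x : Space A) : ℝ :=
  ∑ i ∈ Finset.range n, φ (shift^[i] x)

/-- The cylinder set determined by a word. -/
def cyl (A : ℕ → ℕ → Bool) (w : List ℕ) : Set (Space A) :=
  {x | ∀ i : Fin w.length, x.1 i = w.get i}

/-- Concatenation of a finite word with a sequence. -/
def concatSeq (w : List ℕ) (u : ℕ → ℕ) : ℕ → ℕ :=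
  fun i => if h : i < w.length then w.get ⟨i, h⟩ else u (i - w.length)

/-- Prepending a single symbol to a sequence. -/
def prependSeq (a : ℕ) (u : ℕ → ℕ) : ℕ → ℕ := fun i => Nat.casesOn i a u

/-- The set of points to which the symbol `a` may be prepended. -/
def admits (A : ℕ → ℕ → Bool) (a : ℕ) : Set (Space A) := {x | A a (x.1 0) = true}

/-- Prepending a symbol to a point of the shift space (identity if not admissible). -/
noncomputable def prep (A : ℕ → ℕ → Bool) (a : ℕ) (x : Space A) : Space A :=
  if h : A a (x.1 0) = true then
    ⟨prependSeq a x.1, by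
      intro i
      cases i with
      | zero => exact h
      | succ j => exact x.2 j⟩
  else x

/-- The measure `ν ⊚ σ`, `ν⊚σ(E) = Σ_a ν(σ(E ∩ [a]))`. -/
noncomputable def circ (A : ℕ → ℕ → Bool) (ν : Measure (Space A)) : Measure (Space A) :=
  Measure.sum fun a : ℕ => (ν.restrict (admits A a)).map (prep A a)

/-- `ν` is `(φ, l)`-conformal: `dν/d(ν⊚σ) = l⁻¹ e^φ`. -/
def Conformal (A : ℕ → ℕ → Bool) (φ : Space A → ℝ) (l : ℝ) (ν : Measure (Space A)) : Prop :=
  ∀ E : Set (Space A), MeasurableSet E →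
    ν E = ∫⁻ x in E, ENNReal.ofReal (l⁻¹ * Real.exp (φ x)) ∂(circ A ν)

/-- The Ruelle transfer operator. -/
noncomputable def ruelle (A : ℕ → ℕ → Bool) (φ f : Space A → ℝ) (x : Space A) : ℝ :=
  ∑' a : ℕ, if A a (x.1 0) = true then Real.exp (φ (prep A a x)) * f (prep A a x) else 0

/-- The Ruelle operator applied to the constant function 1, valued in `ℝ≥0∞`. -/
noncomputable def ruelleOne (A : ℕ → ℕ → Bool) (φ : Space A → ℝ) (x : Space A) : ℝ≥0∞ :=
  ∑' a : ℕ, if A a (x.1 0) = true then ENNReal.ofReal (Real.exp (φ (prep A a x))) else 0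

/-- `L*_φ ν = l ν` : the dual eigenmeasure equation. -/
def DualEigen (A : ℕ → ℕ → Bool) (φ : Space A → ℝ) (l : ℝ) (ν : Measure (Space A)) : Prop :=
  ∀ f : Space A → ℝ, Integrable f ν →
    ∫ x, ruelle A φ f x ∂ν = l * ∫ x, f x ∂ν

/-- The sub-σ-algebra `σ^{-n} 𝓑`. -/
def shiftSigma (A : ℕ → ℕ → Bool) (n : ℕ) : MeasurableSpace (Space A) :=
  MeasurableSpace.comap (shift^[n]) inferInstance

/-- A sub-σ-algebra `m` is compatible with `ν`: the restriction of `ν` to `m` is σ-finite. -/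
def Compatible (A : ℕ → ℕ → Bool) (ν : Measure (Space A))
    (m : MeasurableSpace (Space A)) : Prop :=
  ∃ s : ℕ → Set (Space A), (∀ k, MeasurableSet[m] (s k)) ∧ (∀ k, ν (s k) ≠ ⊤) ∧
    (⋃ k, s k) = Set.univ

open Classical in
/-- Numerator of the DLR kernel: `e^{φ_n(w σ^n x)} 1{w σ^n x ∈ Σ_A}`. -/
noncomputable def dlrNum (A : ℕ → ℕ → Bool) (φ : Space A → ℝ) (w : List ℕ)
    (x : Space A) : ℝ :=
  if h : IsAdm A (concatSeq w ((shift^[w.length] x).1)) then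
    Real.exp (birkhoff φ w.length (⟨concatSeq w ((shift^[w.length] x).1), h⟩ : Space A))
  else 0

/-- Denominator of the DLR kernel: `Σ_{y : σ^n y = σ^n x} e^{φ_n(y)}`. -/
noncomputable def dlrDen (A : ℕ → ℕ → Bool) (φ : Space A → ℝ) (n : ℕ) (x : Space A) : ℝ :=
  ∑' y : {y : Space A // shift^[n] y = shift^[n] x}, Real.exp (birkhoff φ n y.1)

/-- `ν` is a `φ`-DLR measure. -/
def IsDLR (A : ℕ → ℕ → Bool) (φ : Space A → ℝ) (ν : Measure (Space A)) : Prop :=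
  ∀ n : ℕ, 1 ≤ n →
    Compatible A ν (shiftSigma A n) ∧
    ∀ w : List ℕ, w.length = n →
      (ν[Set.indicator (cyl A w) (fun _ => (1 : ℝ))|shiftSigma A n])
        =ᵐ[ν] fun x => dlrNum A φ w x / dlrDen A φ n x

/-- `ν` is non-singular: `ν ∘ σ⁻¹ ∼ ν`. -/
def NonSingular (A : ℕ → ℕ → Bool) (ν : Measure (Space A)) : Prop :=
  ν.map shift ≪ ν ∧ ν ≪ ν.map shift

/-- Conservative non-singular measure. -/
def Conservative (A : ℕ → ℕ → Bool) (ν : Measure (Space A)) : Prop :=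
  NonSingular A ν ∧
    ∀ W : Set (Space A), MeasurableSet W →
      (∀ i j : ℕ, i ≠ j → ν ((shift^[i] ⁻¹' W) ∩ (shift^[j] ⁻¹' W)) = 0) → ν W = 0

/-- The `n`-th variation `Var_n φ`, valued in `ℝ≥0∞`. -/
noncomputable def varn (A : ℕ → ℕ → Bool) (φ : Space A → ℝ) (n : ℕ) : ℝ≥0∞ :=
  ⨆ (x : Space A) (y : Space A) (_ : ∀ i, i < n → x.1 i = y.1 i),
    ENNReal.ofReal |φ x - φ y|

noncomputable def waltersBound (A : ℕ → ℕ → Bool) (φ : Space A → ℝ) (k : ℕ) : ℝ≥0∞ :=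
  ⨆ (n : ℕ) (_ : 1 ≤ n), varn A (birkhoff φ n) (n + k)

/-- The Walters condition. -/
def Walters (A : ℕ → ℕ → Bool) (φ : Space A → ℝ) : Prop :=
  (∀ k, 1 ≤ k → waltersBound A φ k ≠ ⊤) ∧
  Tendsto (waltersBound A φ) atTop (nhds 0)

/-- `φ` is weakly Hölder continuous. -/
def WeaklyHolder (A : ℕ → ℕ → Bool) (φ : Space A → ℝ) : Prop :=
  ∃ H θ : ℝ, 0 < H ∧ θ ∈ Set.Ioo (0 : ℝ) 1 ∧
    ∀ n : ℕ, 2 ≤ n → varn A φ n ≤ ENNReal.ofReal (H * θ ^ n)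

/-- The partition function `Z_n(φ, a)`, valued in `ℝ≥0∞`. -/
noncomputable def Zn (A : ℕ → ℕ → Bool) (φ : Space A → ℝ) (n a : ℕ) : ℝ≥0∞ :=
  ∑' x : {x : Space A // shift^[n] x = x ∧ x.1 0 = a},
    ENNReal.ofReal (Real.exp (birkhoff φ n x.1))

/-- The partition function `Z*_n(φ, a)` over periodic points whose first return to `[a]` is `n`. -/
noncomputable def Znstar (A : ℕ → ℕ → Bool) (φ : Space A → ℝ) (n a : ℕ) : ℝ≥0∞ :=
  ∑' x : {x : Space A // shift^[n] x = x ∧ x.1 0 = a ∧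
      ∀ k, 0 < k → k < n → (shift^[k] x).1 0 ≠ a},
    ENNReal.ofReal (Real.exp (birkhoff φ n x.1))

/-- `P` is the (finite) Gurevich pressure of `φ`. -/
def HasGurevich (A : ℕ → ℕ → Bool) (φ : Space A → ℝ) (P : ℝ) : Prop :=
  ∀ a : ℕ, (cyl A [a]).Nonempty →
    (∀ n, 1 ≤ n → Zn A φ n a ≠ ⊤) ∧
    Tendsto (fun n : ℕ => Real.log (Zn A φ n a).toReal / n) atTop (nhds P)

/-- `φ` is recurrent (with Gurevich pressure `P`). -/
def Recurrent (A : ℕ → ℕ → Bool) (φ : Space A → ℝ) (P : ℝ) : Prop :=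
  ∀ a : ℕ, (cyl A [a]).Nonempty →
    ∑' n : ℕ, ENNReal.ofReal (Real.exp (-((n + 1 : ℕ) : ℝ) * P)) * Zn A φ (n + 1) a = ⊤

/-- `φ` is positive recurrent (with Gurevich pressure `P`). -/
def PosRecurrent (A : ℕ → ℕ → Bool) (φ : Space A → ℝ) (P : ℝ) : Prop :=
  Recurrent A φ P ∧
  ∀ a : ℕ, (cyl A [a]).Nonempty →
    ∑' n : ℕ, ((n + 1 : ℕ) : ℝ≥0∞) *
      ENNReal.ofReal (Real.exp (-((n + 1 : ℕ) : ℝ) * P)) * Znstar A φ (n + 1) a ≠ ⊤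

/-- `φ` is transient (with Gurevich pressure `P`). -/
def Transient (A : ℕ → ℕ → Bool) (φ : Space A → ℝ) (P : ℝ) : Prop :=
  ∀ a : ℕ, (cyl A [a]).Nonempty →
    ∑' n : ℕ, ENNReal.ofReal (Real.exp (-((n + 1 : ℕ) : ℝ) * P)) * Zn A φ (n + 1) a ≠ ⊤

/-- `Σ_A` is topologically mixing. -/
def TopMixing (A : ℕ → ℕ → Bool) : Prop :=
  ∀ a b : ℕ, ∃ N : ℕ, ∀ n, N < n → ∃ x : Space A, x.1 0 = a ∧ (shift^[n] x).1 0 = b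

/-- The big images and preimages (BIP) property. -/
def BIP (A : ℕ → ℕ → Bool) : Prop :=
  ∃ (N : ℕ) (b : Fin N → ℕ), ∀ a : ℕ,
    (∃ i, A (b i) a = true) ∧ (∃ j, A a (b j) = true)

/-- An admissible word. -/
def AdmWord (A : ℕ → ℕ → Bool) (w : List ℕ) : Prop :=
  ∀ (i : ℕ) (h : i + 1 < w.length),
    A (w.get ⟨i, Nat.lt_of_succ_lt h⟩) (w.get ⟨i + 1, h⟩) = true

/-- The image of `E ⊆ [a̲]` under the cylinder-swapping map `v_{a̲,b̲}`. -/
def swapImage (A : ℕ → ℕ → Bool) (b : List ℕ) (E : Set (Space A)) : Set (Space A) :=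
  {y | ∃ x ∈ E, y.1 = concatSeq b ((shift^[b.length] x).1)}

/-- The image of `E` under the prepending map `I_b`. -/
def prepImage (A : ℕ → ℕ → Bool) (b : ℕ) (E : Set (Space A)) : Set (Space A) :=
  {y | ∃ x ∈ E, y.1 = prependSeq b x.1}

/-- The transition matrix of the renewal shift:
`A(1,1) = A(1,i) = A(i,i-1) = 1` (for `i > 1`), all other entries `0`. -/
def renA : ℕ → ℕ → Bool := fun i j => decide ((i = 1 ∧ 1 ≤ j) ∨ (2 ≤ i ∧ j = i - 1))

/-- The transition matrix of the shift `Σ_{𝓡⁻}`: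
`A(i,i+1) = A(i,1) = 1` for `i ≥ 1`, all other entries `0`. -/
def rminusA : ℕ → ℕ → Bool := fun i j => decide (1 ≤ i ∧ (j = i + 1 ∨ j = 1))

/-- The periodic sequence obtained by repeating the word `w`. -/
def perSeq (w : List ℕ) : ℕ → ℕ := fun i => w.getD (i % w.length) 0

/-- The word `(j, j-1, …, 1, n, n-1, …, j+1)`. -/
def gammaWord (j n : ℕ) : List ℕ :=
  ((List.range j).map (· + 1)).reverse ++ ((List.range (n - j)).map (· + (j + 1))).reverse

/-- The point `x̄ = (1, 2, 3, …)` of `Σ_{𝓡⁻}`. -/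
def xbar : Space rminusA := ⟨fun i => i + 1, by intro i; simp [rminusA]⟩

theorem WeaklyHolder.exists_abs_sub_le {A : ℕ → ℕ → Bool} {φ : Space A → ℝ}
    (h : WeaklyHolder A φ) : ∃ H θ : ℝ, 0 < H ∧ θ ∈ Set.Ioo (0 : ℝ) 1 ∧
      ∀ n : ℕ, 2 ≤ n → ∀ x y : Space A, (∀ i, i < n → x.1 i = y.1 i) →
        |φ x - φ y| ≤ H * θ ^ n := by
  obtain ⟨H, θ, hH, hθ, hv⟩ := h
  refine ⟨H, θ, hH, hθ, fun n hn x y hxy => ?_⟩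
  have h1 : ENNReal.ofReal |φ x - φ y| ≤ varn A φ n :=
    le_iSup_of_le x (le_iSup_of_le y (le_iSup_of_le hxy le_rfl))
  exact (ENNReal.ofReal_le_ofReal_iff (by have := hθ.1; positivity)).1 (h1.trans (hv n hn))

theorem WeaklyHolder.continuous {A : ℕ → ℕ → Bool} {φ : Space A → ℝ}
    (h : WeaklyHolder A φ) : Continuous φ := by
  obtain ⟨H, θ, hH, hθ, hv⟩ := h.exists_abs_sub_le
  rw [continuous_iff_continuousAt]
  intro x
  rw [ContinuousAt, Metric.tendsto_nhds]
  intro ε hε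
  have hlim : Tendsto (fun n : ℕ => H * θ ^ n) atTop (𝓝 (H * 0)) :=
    (tendsto_pow_atTop_nhds_zero_of_lt_one hθ.1.le hθ.2).const_mul H
  rw [mul_zero] at hlim
  obtain ⟨n, hn, hn2⟩ := ((hlim.eventually_lt_const hε).and (eventually_ge_atTop 2)).exists
  have hnear : ∀ᶠ y : Space A in 𝓝 x, ∀ i ∈ Finset.range n, y.1 i = x.1 i := by
    rw [Filter.eventually_all_finset]
    intro i _
    have hc : Continuous fun y : Space A => y.1 i := (continuous_apply i).comp continuous_subtype_val
    exact hc.continuousAt.eventually (IsOpen.mem_nhds (isOpen_discrete {x.1 i}) rfl)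
  filter_upwards [hnear] with y hy
  exact (hv n hn2 y x fun i hi => hy i (Finset.mem_range.2 hi)).trans_lt hn

theorem measurable_eval {A : ℕ → ℕ → Bool} (i : ℕ) : Measurable fun x : Space A => x.1 i :=
  (measurable_pi_apply i).comp measurable_subtype_coe

theorem measurable_prep (A : ℕ → ℕ → Bool) (a : ℕ) : Measurable (prep A a) := by
  refine Measurable.subtype_mk (f := fun x => (prep A a x).1) ?_ (h := fun x => (prep A a x).2)
  rw [measurable_pi_iff]
  intro i
  have h : (fun x : Space A => (prep A a x).1 i) =
      fun x => if A a (x.1 0) = true then prependSeq a x.1 i else x.1 i := by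
    funext x
    unfold prep
    split_ifs <;> rfl
  rw [h]
  refine Measurable.ite ?_ ?_ (measurable_eval i)
  · exact measurable_eval 0 (MeasurableSet.of_discrete (s := {k | A a k = true}))
  · cases i with
    | zero => exact measurable_const
    | succ k => exact measurable_eval k

theorem mem_cyl_singleton {A : ℕ → ℕ → Bool} {a : ℕ} {x : Space A} :
    x ∈ cyl A [a] ↔ x.1 0 = a := by
  simp [cyl]

theorem measurableSet_cyl_singleton (A : ℕ → ℕ → Bool) (a : ℕ) :
    MeasurableSet (cyl A [a]) := by
  have h : cyl A [a] = (fun x : Space A => x.1 0) ⁻¹' {a} := by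
    ext x
    simp [mem_cyl_singleton]
  rw [h]
  exact measurable_eval 0 (measurableSet_singleton a)

theorem ruelle_indicator_cyl (A : ℕ → ℕ → Bool) (ψ : Space A → ℝ) (a : ℕ) (x : Space A) :
    ruelle A ψ ((cyl A [a]).indicator fun _ => 1) x =
      (admits A a).indicator (fun x => Real.exp (ψ (prep A a x))) x := by
  have h0 : ∀ b, A b (x.1 0) = true → (prep A b x).1 0 = b := by
    intro b hb
    simp [prep, hb, prependSeq]
  unfold ruelle
  rw [tsum_eq_single a]
  · by_cases ha : A a (x.1 0) = true
    · simp [admits, ha, mem_cyl_singleton, Set.indicator, h0 a ha]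
    · simp [admits, ha]
  · intro b hb
    by_cases hA : A b (x.1 0) = true
    · simp [hA, mem_cyl_singleton, h0 b hA, hb]
    · simp [hA]

/-- A word of the renewal shift starting with `k` decreases down to `1`. -/
theorem renA_apply_of_lt (x : Space renA) {k : ℕ} (hk : x.1 0 = k) :
    ∀ i, i < k → x.1 i = k - i := by
  intro i
  induction i with
  | zero => intro _; simpa using hk
  | succ i ih =>
    intro hi
    have h1 := ih (by omega)
    have h2 := x.2 i
    simp only [renA, decide_eq_true_eq] at h2
    omega

theorem renA_apply_zero_pos (x : Space renA) : 1 ≤ x.1 0 := by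
  have h2 := x.2 0
  simp only [renA, decide_eq_true_eq] at h2
  omega

theorem admits_renA {j : ℕ} (hj : 1 ≤ j) : admits renA (j + 1) = cyl renA [j] := by
  ext x
  rw [mem_cyl_singleton]
  simp only [admits, renA, Set.mem_ofPred_eq, decide_eq_true_eq]
  omega

theorem prep_renA_zero {j : ℕ} {x : Space renA} (hx : x ∈ admits renA j) :
    (prep renA j x).1 0 = j := by
  have h : renA j (x.1 0) = true := hx
  simp [prep, h, prependSeq]

theorem perSeq_gammaWord_zero {j n : ℕ} (hj : 1 ≤ j) : perSeq (gammaWord j n) 0 = j := by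
  obtain ⟨k, rfl⟩ : ∃ k, j = k + 1 := ⟨j - 1, by omega⟩
  simp [perSeq, gammaWord, List.range_succ]

section Eigenmeasure

variable {ψ : Space renA → ℝ} {l : ℝ} {ν : Measure (Space renA)}

theorem DualEigen.real_cyl_succ (heig : DualEigen renA ψ l ν)
    (hcyl : ∀ w : List ℕ, w ≠ [] → ν (cyl renA w) ≠ ⊤) {j : ℕ} (hj : 1 ≤ j) :
    ∫ x in cyl renA [j], Real.exp (ψ (prep renA (j + 1) x)) ∂ν =
      l * ν.real (cyl renA [j + 1]) := by
  have hm := measurableSet_cyl_singleton renA (j + 1)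
  have hint : Integrable ((cyl renA [j + 1]).indicator fun _ => (1 : ℝ)) ν :=
    (integrable_indicator_iff hm).2 (integrableOn_const (hcyl _ (by simp)))
  have h := heig _ hint
  simp_rw [ruelle_indicator_cyl] at h
  rw [admits_renA hj, integral_indicator (measurableSet_cyl_singleton renA j),
    integral_indicator hm] at h
  simpa using h

theorem DualEigen.mul_real_cyl_le (heig : DualEigen renA ψ l ν)
    (hcyl : ∀ w : List ℕ, w ≠ [] → ν (cyl renA w) ≠ ⊤) (hψ : Measurable ψ)
    {j : ℕ} (hj : 1 ≤ j) {c d : ℝ}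
    (hcd : ∀ y : Space renA, y.1 0 = j + 1 → |ψ y - c| ≤ d) :
    Real.exp (c - d) * ν.real (cyl renA [j]) ≤ l * ν.real (cyl renA [j + 1]) := by
  have hm := measurableSet_cyl_singleton renA j
  have hfin := hcyl [j] (by simp)
  have hb : ∀ x ∈ cyl renA [j], |ψ (prep renA (j + 1) x) - c| ≤ d := fun x hx =>
    hcd _ (prep_renA_zero (by rwa [admits_renA hj]))
  rw [← heig.real_cyl_succ hcyl hj, mul_comm, ← smul_eq_mul, ← setIntegral_const]
  refine setIntegral_mono_on (integrableOn_const hfin) ?_ hm fun x hx => ?_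
  · refine Measure.integrableOn_of_bounded (M := Real.exp (c + d)) hfin
      (hψ.comp (measurable_prep renA (j + 1))).exp.aestronglyMeasurable ?_
    filter_upwards [ae_restrict_mem hm] with x hx
    rw [Real.norm_eq_abs, Real.abs_exp, Real.exp_le_exp]
    linarith [(abs_le.1 (hb x hx)).2]
  · rw [Real.exp_le_exp]
    linarith [(abs_le.1 (hb x hx)).1]

theorem DualEigen.exp_sum_mul_real_cyl_le (heig : DualEigen renA ψ l ν)
    (hcyl : ∀ w : List ℕ, w ≠ [] → ν (cyl renA w) ≠ ⊤) (hψ : Measurable ψ) (hl : 0 ≤ l)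
    {c d : ℕ → ℝ} {n : ℕ}
    (hcd : ∀ j ∈ Finset.Icc 2 n, ∀ y : Space renA, y.1 0 = j → |ψ y - c j| ≤ d j) (hn : 1 ≤ n) :
    Real.exp (∑ j ∈ Finset.Icc 2 n, (c j - d j)) * ν.real (cyl renA [1]) ≤
      l ^ (n - 1) * ν.real (cyl renA [n]) := by
  induction n, hn using Nat.le_induction with
  | base => simp
  | succ n hn ih =>
    have hprev := ih fun j hj => hcd j (Finset.Icc_subset_Icc_right (Nat.le_succ n) hj)
    have hstep := heig.mul_real_cyl_le hcyl hψ hn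
      (hcd (n + 1) (Finset.mem_Icc.2 ⟨by omega, le_rfl⟩))
    rw [Finset.sum_Icc_succ_top (by omega), add_comm, Real.exp_add, mul_assoc]
    obtain ⟨m, rfl⟩ : ∃ m, n = m + 1 := ⟨n - 1, by omega⟩
    simp only [Nat.add_sub_cancel] at hprev ⊢
    calc _ ≤ Real.exp (c (m + 1 + 1) - d (m + 1 + 1)) * (l ^ m * ν.real (cyl renA [m + 1])) := by
          gcongr
      _ = l ^ m * (Real.exp (c (m + 1 + 1) - d (m + 1 + 1)) * ν.real (cyl renA [m + 1])) := by ring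
      _ ≤ l ^ m * (l * ν.real (cyl renA [m + 1 + 1])) := by gcongr
      _ = _ := by ring

theorem DualEigen.real_cyl_one_pos (heig : DualEigen renA ψ l ν)
    (hcyl : ∀ w : List ℕ, w ≠ [] → ν (cyl renA w) ≠ ⊤) (hl : 0 < l) (hν : ν ≠ 0) :
    0 < ν.real (cyl renA [1]) := by
  refine lt_of_le_of_ne measureReal_nonneg fun h0 => hν ?_
  have hz : ∀ j, 1 ≤ j → ν (cyl renA [j]) = 0 := by
    intro j hj
    induction j, hj using Nat.le_induction with
    | base => exact (measureReal_eq_zero_iff (hcyl _ (by simp))).1 h0.symm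
    | succ j hj ih =>
      have h := heig.real_cyl_succ hcyl hj
      rw [setIntegral_measure_zero _ ih, eq_comm, mul_eq_zero] at h
      exact (measureReal_eq_zero_iff (hcyl _ (by simp))).1 (h.resolve_left hl.ne')
  rw [← Measure.measure_univ_eq_zero]
  refine measure_mono_null (t := ⋃ j : ℕ, cyl renA [j + 1]) (fun x _ => ?_)
    (measure_iUnion_null fun j => hz _ (by omega))
  have := renA_apply_zero_pos x
  exact Set.mem_iUnion.2 ⟨x.1 0 - 1, mem_cyl_singleton.2 (by omega)⟩

end Eigenmeasure

theorem tendsto_measureReal_cyl_singleton {A : ℕ → ℕ → Bool} (ν : Measure (Space A))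
    [IsFiniteMeasure ν] : Tendsto (fun n : ℕ => ν.real (cyl A [n])) atTop (𝓝 0) := by
  have hdisj : Pairwise (Function.onFun Disjoint fun n : ℕ => cyl A [n]) := by
    intro a b hab
    rw [Function.onFun, Set.disjoint_left]
    intro x ha hb
    exact hab ((mem_cyl_singleton.1 ha).symm.trans (mem_cyl_singleton.1 hb))
  have hsum : ∑' n : ℕ, ν (cyl A [n]) ≠ ⊤ := by
    rw [← measure_iUnion hdisj fun n => measurableSet_cyl_singleton A n]
    exact measure_ne_top _ _
  exact (ENNReal.summable_toReal hsum).tendsto_atTop_zero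

theorem statement15 (φ : Space renA → ℝ) (hH : WeaklyHolder renA φ)
    (β : ℝ) (hβ : 0 < β)
    (P : ℝ) (hP : HasGurevich renA (fun x => β * φ x) P)
    (ν : Measure (Space renA)) (hν0 : ν ≠ 0) (hsf : SigmaFinite ν)
    (hcyl : ∀ w : List ℕ, w ≠ [] → ν (cyl renA w) ≠ ⊤)
    (heig : DualEigen renA (fun x => β * φ x) (Real.exp P) ν)
    (γ : ℕ → ℕ → Space renA)
    (hγ : ∀ j n : ℕ, 1 ≤ j → j ≤ n → (γ j n).1 = perSeq (gammaWord j n))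
    (hlim : ((P / β : ℝ) : EReal) < Filter.limsup
        (fun n : ℕ => (((∑ j ∈ Finset.Icc 2 n, φ (γ j n)) / n : ℝ) : EReal)) atTop) :
    ν Set.univ = ⊤ := by
  by_contra htop
  have : IsFiniteMeasure ν := ⟨lt_top_iff_ne_top.2 htop⟩
  obtain ⟨H, θ, hHpos, hθ, hv⟩ := hH.exists_abs_sub_le
  have hψ : Measurable fun x => β * φ x := hH.continuous.measurable.const_mul β
  have hpos := heig.real_cyl_one_pos hcyl (Real.exp_pos P) hν0
  set C := β * (H * (1 - θ)⁻¹) with hC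
  have hevent := (tendsto_measureReal_cyl_singleton ν).eventually_lt_const
    (show 0 < Real.exp (P - C) * ν.real (cyl renA [1]) by positivity)
  obtain ⟨n, hlt, hsmall, hn⟩ := ((Filter.frequently_lt_of_lt_limsup (by isBoundedDefault)
    hlim).and_eventually (hevent.and (eventually_ge_atTop 1))).exists
  refine absurd hsmall (not_lt.2 ?_)
  have hn0 : (0 : ℝ) < n := by exact_mod_cast hn
  rw [EReal.coe_lt_coe_iff, div_lt_div_iff₀ hβ hn0] at hlt
  have hcd : ∀ j ∈ Finset.Icc 2 n, ∀ y : Space renA, y.1 0 = j →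
      |β * φ y - β * φ (γ j n)| ≤ β * (H * θ ^ j) := by
    intro j hj y hy
    obtain ⟨hj2, hjn⟩ := Finset.mem_Icc.1 hj
    have hγ0 : (γ j n).1 0 = j := by
      rw [hγ j n (by omega) hjn, perSeq_gammaWord_zero (by omega)]
    rw [← mul_sub, abs_mul, abs_of_pos hβ]
    refine mul_le_mul_of_nonneg_left (hv j hj2 _ _ fun i hi => ?_) hβ.le
    rw [renA_apply_of_lt y hy i hi, renA_apply_of_lt _ hγ0 i hi]
  have hmain := heig.exp_sum_mul_real_cyl_le hcyl hψ (Real.exp_pos P).le hcd hn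
  have hgeom : ∑ j ∈ Finset.Icc 2 n, θ ^ j ≤ (1 - θ)⁻¹ := by
    rw [← tsum_geometric_of_lt_one hθ.1.le hθ.2]
    exact (summable_geometric_of_lt_one hθ.1.le hθ.2).sum_le_tsum _
      fun j _ => pow_nonneg hθ.1.le j
  have hexp : P * n - C ≤ ∑ j ∈ Finset.Icc 2 n, (β * φ (γ j n) - β * (H * θ ^ j)) := by
    rw [Finset.sum_sub_distrib, ← Finset.mul_sum, ← Finset.mul_sum, ← Finset.mul_sum]
    have : β * (H * ∑ j ∈ Finset.Icc 2 n, θ ^ j) ≤ C := by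
      rw [hC]
      gcongr
    linarith
  have hpow : Real.exp P ^ (n - 1) = Real.exp (P * n - P) := by
    rw [← Real.exp_nat_mul, Nat.cast_sub hn]
    congr 1
    push_cast
    ring
  rw [hpow] at hmain
  refine le_of_mul_le_mul_left ?_ (Real.exp_pos (P * n - P))
  rw [← mul_assoc, ← Real.exp_add]
  refine le_trans ?_ hmain
  gcongr
  linarith

end CMS
end

section
/- Let Σ_{𝓡⁻} be the topological Markov shift whose transition matrix satisfies A(i, i+1) = A(i, 1) = 1 for every i ≥ 1 and all other entries are 0, and let φ : Σ_{𝓡⁻} → ℝ be weakly Hölder continuous with sup φ < ∞, Var_2 φ = 0 (so φ(x) depends only on (x_0, x_1); write φ(n,1) for its value at any point x with x_0 = n and x_1 = 1), and φ_n(γ_n) = 0 for every n ≥ 1, where γ_n is the periodic point with period word (1, 2, …, n). Let β > 0 and let ν be a nonzero σ-finite Borel measure on Σ_{𝓡⁻}, finite on every cylinder, with L*_{βφ} ν = 2 ν. Then: (i) if limsup_{n→∞} φ(n,1)/n < 0, then ν(Σ_{𝓡⁻}) < ∞; (ii) if limsup_{n→∞} φ(n,1)/n > 0, then ν(Σ_{𝓡⁻})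 = ∞. -/
open MeasureTheory Filter Topology ENNReal

namespace CMS

/-- The set of points with a prescribed symbol at time `0`. -/
def startSet (n : ℕ) : Set (Space rminusA) := {x | x.1 0 = n}

/-- The set of points with prescribed symbols at times `0` and `1`. -/
def startPairSet (i j : ℕ) : Set (Space rminusA) := {x | x.1 0 = i ∧ x.1 1 = j}

lemma measurable_coord (k : ℕ) : Measurable fun x : Space rminusA => x.1 k :=
  (measurable_pi_apply k).comp measurable_subtype_coe

lemma measurableSet_startSet (n : ℕ) : MeasurableSet (startSet n) :=
  measurable_coord 0 (measurableSet_singleton n)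

lemma measurableSet_startPairSet (i j : ℕ) : MeasurableSet (startPairSet i j) :=
  (measurable_coord 0 (measurableSet_singleton i)).inter
    (measurable_coord 1 (measurableSet_singleton j))

lemma startSet_eq_cyl (n : ℕ) : startSet n = cyl rminusA [n] := by
  ext x
  simp [startSet, cyl]

lemma startPairSet_subset (i j : ℕ) : startPairSet i j ⊆ startSet i := fun _ hx => hx.1

lemma startSet_zero : startSet 0 = ∅ := by
  ext x
  have h := x.2 0
  simp only [rminusA, decide_eq_true_eq] at h
  simp only [startSet, Set.mem_ofPred_eq, Set.mem_empty_iff_false, iff_false]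
  omega

lemma startSet_succ (n : ℕ) :
    startSet (n + 1) = startPairSet (n + 1) 1 ∪ startPairSet (n + 1) (n + 2) := by
  ext x
  have h := x.2 0
  simp only [rminusA, decide_eq_true_eq] at h
  simp only [startSet, startPairSet, Set.mem_union, Set.mem_ofPred_eq]
  simp only [zero_add] at h
  omega

lemma disjoint_startPairSet (n : ℕ) :
    Disjoint (startPairSet (n + 1) 1) (startPairSet (n + 1) (n + 2)) := by
  rw [Set.disjoint_left]
  rintro x ⟨-, h⟩ ⟨-, h'⟩
  omega

lemma prep_apply_zero {A : ℕ → ℕ → Bool} {a : ℕ} {x : Space A} (h : A a (x.1 0) = true) :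
    (prep A a x).1 0 = a := by
  simp [prep, h, prependSeq]

lemma prep_apply_succ {A : ℕ → ℕ → Bool} {a : ℕ} {x : Space A} (h : A a (x.1 0) = true) (k : ℕ) :
    (prep A a x).1 (k + 1) = x.1 k := by
  simp [prep, h, prependSeq]

lemma shift_iterate_apply {A : ℕ → ℕ → Bool} (k : ℕ) (x : Space A) (i : ℕ) :
    (shift^[k] x).1 i = x.1 (i + k) := by
  induction k generalizing x with
  | zero => rfl
  | succ k ih =>
    rw [Function.iterate_succ_apply, ih]
    simp only [shift]
    congr 1

/-- A potential with vanishing second variation depends only on the first two coordinates. -/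
lemma eq_of_varn_two_eq_zero {A : ℕ → ℕ → Bool} {φ : Space A → ℝ} (h : varn A φ 2 = 0)
    {x y : Space A} (h0 : x.1 0 = y.1 0) (h1 : x.1 1 = y.1 1) : φ x = φ y := by
  have hle : ENNReal.ofReal |φ x - φ y| ≤ varn A φ 2 := by
    unfold varn
    refine le_iSup_of_le x (le_iSup_of_le y (le_iSup_of_le ?_ le_rfl))
    intro i hi
    interval_cases i
    exacts [h0, h1]
  rw [h, nonpos_iff_eq_zero, ENNReal.ofReal_eq_zero] at hle
  exact sub_eq_zero.1 (abs_nonpos_iff.1 hle)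

/-- The Ruelle operator maps the indicator of `[i, j]` to a multiple of the indicator of `[j]`
when the potential is constant on `[i, j]`. -/
lemma ruelle_indicator_startPairSet {ψ : Space rminusA → ℝ} {i j : ℕ} {c : ℝ}
    (hij : rminusA i j = true) (hψ : ∀ x ∈ startPairSet i j, ψ x = c) :
    ruelle rminusA ψ ((startPairSet i j).indicator fun _ => 1) =
      (startSet j).indicator fun _ => Real.exp c := by
  funext x
  unfold ruelle
  rw [tsum_eq_single i]
  · by_cases hx : x.1 0 = j
    · have hA : rminusA i (x.1 0) = true := by rw [hx]; exact hij
      have hmem : prep rminusA i x ∈ startPairSet i j :=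
        ⟨prep_apply_zero hA, (prep_apply_succ hA 0).trans hx⟩
      have hxj : x ∈ startSet j := hx
      rw [if_pos hA, hψ _ hmem, Set.indicator_of_mem hmem, Set.indicator_of_mem hxj, mul_one]
    · have hxj : x ∉ startSet j := hx
      rw [Set.indicator_of_notMem hxj]
      split_ifs with hA
      · rw [Set.indicator_of_notMem, mul_zero]
        rintro ⟨-, h1⟩
        exact hx ((prep_apply_succ hA 0).symm.trans h1)
      · rfl
  · intro a ha
    split_ifs with hA
    · rw [Set.indicator_of_notMem, mul_zero]
      rintro ⟨h0, -⟩
      exact ha ((prep_apply_zero hA).symm.trans h0)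
    · rfl

lemma DualEigen.measureReal_startPairSet {ψ : Space rminusA → ℝ} {l : ℝ}
    {ν : Measure (Space rminusA)} (heig : DualEigen rminusA ψ l ν) {i j : ℕ} {c : ℝ}
    (hfin : ν (startSet i) ≠ ⊤) (hij : rminusA i j = true)
    (hψ : ∀ x ∈ startPairSet i j, ψ x = c) :
    l * ν.real (startPairSet i j) = Real.exp c * ν.real (startSet j) := by
  have hpair : ν (startPairSet i j) ≠ ⊤ :=
    ne_top_of_le_ne_top hfin (measure_mono (startPairSet_subset i j))
  have h := heig ((startPairSet i j).indicator fun _ => 1)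
    ((integrable_indicator_iff (measurableSet_startPairSet i j)).2
      (integrableOn_const hpair))
  rw [ruelle_indicator_startPairSet hij hψ,
    integral_indicator_const _ (measurableSet_startSet j),
    integral_indicator_const _ (measurableSet_startPairSet i j)] at h
  simp only [smul_eq_mul, mul_one] at h
  rw [← h, mul_comm]

/-- The sum of the potential along the ascending path from `1` to `n + 1` cancels its value on
`[n + 1, 1]`. -/
lemma sum_xbar_add_eq_zero {φ : Space rminusA → ℝ} (hvar2 : varn rminusA φ 2 = 0)
    {γ : ℕ → Space rminusA} (hγ : ∀ n, 1 ≤ n → ∀ i, (γ n).1 i = (i % n) + 1)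
    (hγ0 : ∀ n, 1 ≤ n → birkhoff φ n (γ n) = 0) (n : ℕ) {x : Space rminusA}
    (hx : x ∈ startPairSet (n + 1) 1) :
    ∑ k ∈ Finset.range n, φ (shift^[k] xbar) + φ x = 0 := by
  rw [← hγ0 (n + 1) (by omega), birkhoff, Finset.sum_range_succ]
  congr 1
  · refine Finset.sum_congr rfl fun k hk => ?_
    have hk' := Finset.mem_range.1 hk
    apply eq_of_varn_two_eq_zero hvar2 <;>
    · rw [shift_iterate_apply, shift_iterate_apply, hγ _ (by omega), Nat.mod_eq_of_lt (by omega)]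
      rfl
  · apply eq_of_varn_two_eq_zero hvar2
    · rw [shift_iterate_apply, hγ _ (by omega), Nat.mod_eq_of_lt (by omega), hx.1]
      omega
    · rw [shift_iterate_apply, hγ _ (by omega), hx.2, add_comm 1 n, Nat.mod_self]

/-- An eigenmeasure for the eigenvalue `2` satisfies `ν [n + 1] = exp (β φ(n + 1, 1)) ν [1]`. -/
lemma measureReal_startSet_succ {φ : Space rminusA → ℝ} (hvar2 : varn rminusA φ 2 = 0)
    {γ : ℕ → Space rminusA} (hγ : ∀ n, 1 ≤ n → ∀ i, (γ n).1 i = (i % n) + 1)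
    (hγ0 : ∀ n, 1 ≤ n → birkhoff φ n (γ n) = 0) {β : ℝ} {ν : Measure (Space rminusA)}
    (hfin : ∀ n, ν (startSet n) ≠ ⊤)
    (heig : DualEigen rminusA (fun x => β * φ x) 2 ν) (n : ℕ) :
    ν.real (startSet (n + 1)) =
      Real.exp (-(β * ∑ k ∈ Finset.range n, φ (shift^[k] xbar))) * ν.real (startSet 1) := by
  induction n with
  | zero => simp
  | succ n ih =>
    set S := ∑ k ∈ Finset.range n, φ (shift^[k] xbar) with hS
    have h1 := heig.measureReal_startPairSet (i := n + 1) (j := 1) (c := -(β * S)) (hfin _)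
      (by simp [rminusA]) fun x hx => by
        have := sum_xbar_add_eq_zero hvar2 hγ hγ0 n hx
        rw [← hS] at this
        rw [eq_neg_of_add_eq_zero_right this, mul_neg]
    have h2 := heig.measureReal_startPairSet (i := n + 1) (j := n + 2)
      (c := β * φ (shift^[n] xbar)) (hfin _) (by simp [rminusA]) fun x hx => by
        have : φ x = φ (shift^[n] xbar) := by
          apply eq_of_varn_two_eq_zero hvar2
          · rw [shift_iterate_apply, hx.1]; simp [xbar]
          · rw [shift_iterate_apply, hx.2]; simp [xbar]; omega
        rw [this]
    have h3 : ν.real (startSet (n + 1)) =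
        ν.real (startPairSet (n + 1) 1) + ν.real (startPairSet (n + 1) (n + 2)) := by
      rw [startSet_succ]
      exact measureReal_union (disjoint_startPairSet n) (measurableSet_startPairSet _ _)
        (ne_top_of_le_ne_top (hfin _) (measure_mono (startPairSet_subset _ _)))
        (ne_top_of_le_ne_top (hfin _) (measure_mono (startPairSet_subset _ _)))
    have h4 : Real.exp (β * φ (shift^[n] xbar)) * ν.real (startSet (n + 2)) =
        Real.exp (-(β * S)) * ν.real (startSet 1) := by linarith
    rw [Finset.sum_range_succ, ← hS, mul_add, neg_add, Real.exp_add, mul_right_comm, ← h4,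
      mul_right_comm, ← Real.exp_add, add_neg_cancel, Real.exp_zero, one_mul]

lemma measure_univ_eq_tsum (ν : Measure (Space rminusA)) :
    ν Set.univ = ∑' n, ν (startSet (n + 1)) := by
  have hU : (Set.univ : Set (Space rminusA)) = ⋃ n, startSet (n + 1) := by
    refine (Set.eq_univ_of_forall fun x => Set.mem_iUnion.2 ⟨x.1 0 - 1, ?_⟩).symm
    have h0 : x.1 0 ≠ 0 := fun h => by
      have hx : x ∈ startSet 0 := h
      rwa [startSet_zero] at hx
    exact (Nat.sub_add_cancel (Nat.one_le_iff_ne_zero.2 h0)).symm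
  rw [hU, measure_iUnion _ fun n => measurableSet_startSet _]
  intro m n hmn
  refine Set.disjoint_left.2 fun x hm hn => hmn ?_
  exact Nat.succ_injective (hm.symm.trans hn)

theorem statement16 (φ : Space rminusA → ℝ) (hH : WeaklyHolder rminusA φ)
    (hsup : BddAbove (Set.range φ)) (hvar2 : varn rminusA φ 2 = 0)
    (γ : ℕ → Space rminusA) (hγ : ∀ n, 1 ≤ n → ∀ i, (γ n).1 i = (i % n) + 1)
    (hγ0 : ∀ n, 1 ≤ n → birkhoff φ n (γ n) = 0)
    (pt : ℕ → Space rminusA) (hpt : ∀ n, 1 ≤ n → (pt n).1 0 = n ∧ (pt n).1 1 = 1)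
    (β : ℝ) (hβ : 0 < β)
    (ν : Measure (Space rminusA)) (hν0 : ν ≠ 0) (hsf : SigmaFinite ν)
    (hcyl : ∀ w : List ℕ, w ≠ [] → ν (cyl rminusA w) ≠ ⊤)
    (heig : DualEigen rminusA (fun x => β * φ x) 2 ν) :
    (Filter.limsup (fun n : ℕ => ((φ (pt n) / n : ℝ) : EReal)) atTop < 0 →
      ν Set.univ ≠ ⊤) ∧
    (0 < Filter.limsup (fun n : ℕ => ((φ (pt n) / n : ℝ) : EReal)) atTop →
      ν Set.univ = ⊤) := by
  have hfin : ∀ n, ν (startSet n) ≠ ⊤ := fun n => startSet_eq_cyl n ▸ hcyl [n] (by simp)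
  have hmass : ∀ n, ν (startSet (n + 1)) =
      ENNReal.ofReal (Real.exp (β * φ (pt (n + 1)))) * ν (startSet 1) := by
    intro n
    have h := measureReal_startSet_succ hvar2 hγ hγ0 hfin heig n
    rw [eq_neg_of_add_eq_zero_left
      (sum_xbar_add_eq_zero hvar2 hγ hγ0 n (hpt (n + 1) (by omega))), mul_neg, neg_neg] at h
    rw [← ofReal_measureReal (hfin (n + 1)), h, ENNReal.ofReal_mul (Real.exp_nonneg _),
      ofReal_measureReal (hfin 1)]
  have htotal : ν Set.univ =
      (∑' n, ENNReal.ofReal (Real.exp (β * φ (pt (n + 1))))) * ν (startSet 1) := by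
    rw [measure_univ_eq_tsum, ← ENNReal.tsum_mul_right]
    exact tsum_congr hmass
  have hpos : ν (startSet 1) ≠ 0 := fun h => hν0 <| by
    rw [← Measure.measure_univ_eq_zero, htotal, h, mul_zero]
  rw [htotal]
  constructor
  · intro hlim
    obtain ⟨c, hc, hc0⟩ := EReal.lt_iff_exists_real_btwn.1 hlim
    have hc0' : c < 0 := by exact_mod_cast hc0
    refine ENNReal.mul_ne_top (Summable.tsum_ofReal_ne_top ?_) (hfin 1)
    rw [summable_nat_add_iff (f := fun n => Real.exp (β * φ (pt n))) 1]
    refine Summable.of_norm_bounded_eventually_nat (g := fun n : ℕ => Real.exp (n * (β * c)))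
      (Real.summable_exp_nat_mul_iff.2 (mul_neg_of_pos_of_neg hβ hc0')) ?_
    filter_upwards [eventually_lt_of_limsup_lt hc, eventually_gt_atTop 0] with n hn hn0
    have hn' : φ (pt n) / n < c := by exact_mod_cast hn
    rw [div_lt_iff₀ (by exact_mod_cast hn0)] at hn'
    rw [Real.norm_of_nonneg (Real.exp_nonneg _), Real.exp_le_exp]
    nlinarith
  · intro hlim
    suffices h : ∑' n, ENNReal.ofReal (Real.exp (β * φ (pt (n + 1)))) = ⊤ by
      rw [h, ENNReal.top_mul hpos]
    by_contra hne
    have hlt := (ENNReal.tendsto_atTop_zero_of_tsum_ne_top hne).eventually_lt_const one_pos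
    obtain ⟨N, hN⟩ := eventually_atTop.1 hlt
    obtain ⟨n, hnN, hn⟩ :=
      frequently_atTop.1 (frequently_lt_of_lt_limsup (by isBoundedDefault) hlim) (N + 1)
    have hn' : 0 < φ (pt n) / n := by exact_mod_cast hn
    obtain ⟨k, rfl⟩ : ∃ k, n = k + 1 := ⟨n - 1, by omega⟩
    have hk := hN k (by omega)
    rw [ENNReal.ofReal_lt_one, Real.exp_lt_one_iff] at hk
    have : 0 < φ (pt (k + 1)) := (div_pos_iff_of_pos_right (by positivity)).1 hn'
    nlinarith

end CMS
end

section
/- Let Σ_{𝓡⁻} be the topological Markov shift whose transition matrix satisfies A(i, i+1) = A(i, 1) = 1 for every i ≥ 1 and all other entries are 0, and let x̄ := (1, 2, 3, …) ∈ Σ_{𝓡⁻}. Then for every measurable potential φ : Σ_{𝓡⁻} → ℝ and every λ > 0, the Dirac measure δ_{x̄} is not (φ,λ)-conformal. -/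
open MeasureTheory Filter Topology ENNReal

namespace CMS

lemma measurableSet_admits (A : ℕ → ℕ → Bool) (a : ℕ) : MeasurableSet (admits A a) := by
  have h : Measurable fun x : Space A => x.1 0 :=
    (measurable_pi_apply 0).comp measurable_subtype_coe
  exact h (MeasurableSet.of_discrete (s := {j | A a j = true}))

/-- A point that is not a fixed point of the shift is not an atom of `δ_x ⊚ σ`. -/
lemma circ_dirac_singleton {A : ℕ → ℕ → Bool} {x : Space A} (hx : shift x ≠ x) :
    circ A (Measure.dirac x) {x} = 0 := by
  rw [circ, Measure.sum_apply _ (measurableSet_singleton x), ENNReal.tsum_eq_zero]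
  intro a
  by_cases hm : AEMeasurable (prep A a) ((Measure.dirac x).restrict (admits A a))
  · rw [Measure.map_apply_of_aemeasurable hm (measurableSet_singleton x),
      Measure.restrict_apply' (measurableSet_admits A a)]
    refine measure_mono_null (t := {x}ᶜ) ?_ (by simp)
    rintro y ⟨hy, ha⟩ rfl
    have ha' : A a (y.1 0) = true := ha
    have hp : prep A a y = y := hy
    apply hx
    conv_lhs => rw [← hp, prep, dif_pos ha']
    rfl
  · simp [Measure.map_of_not_aemeasurable hm]

lemma shift_xbar_ne : shift xbar ≠ xbar := fun h => by
  simpa [shift, xbar] using congrFun (congrArg Subtype.val h) 0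

theorem statement18 (φ : Space rminusA → ℝ) (hφ : Measurable φ)
    (l : ℝ) (hl : 0 < l) :
    ¬ Conformal rminusA φ l (Measure.dirac xbar) := by
  intro h
  have h₁ := h {xbar} (measurableSet_singleton xbar)
  rw [setLIntegral_measure_zero _ _ (circ_dirac_singleton shift_xbar_ne)] at h₁
  simp at h₁

end CMS
end
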